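/- Let l ≥ 1 be an integer, let k₁,…,k_l be positive integers with r = Σᵢ kᵢ, and let δ ∈ (0,1). Then there exist constants C = C(r,δ) > 0 and h₀ ≥ 3 such that for every real h ≥ h₀ and every choice of subintervals [Bᵢ, Cᵢ] ⊆ [0,h] (1 ≤ i ≤ l) with lengths dᵢ = Cᵢ − Bᵢ satisfying dᵢ ≥ h^δ for all i, the sum of 𝔖(A₁ ∪ ⋯ ∪ A_l) over all l-tuples (A₁,…,A_l) of sets of integers with Aᵢ ⊆ [Bᵢ, Cᵢ], |Aᵢ| = kᵢ, and |A₁ ∪ ⋯ ∪ A_l| < r (i.e. the sets are not pairwise disjoint) is at most C·h^{−δ}·(log h)^r·∏ᵢ₌₁^l dᵢ^{kᵢ}. -/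

import Mathlib

open Finset

/-- The sieve weight Λ_R(n; H, a) = (1/a!) Σ_{d | P(n,H), d ≤ R} μ(d) (log (R/d))^a,
where P(n,H) = ∏_{h ∈ H} (n+h). -/
noncomputable def lamR (R : ℝ) (n : ℕ) (H : Finset ℕ) (a : ℕ) : ℝ :=
  (1 / (Nat.factorial a : ℝ)) *
    ∑ d ∈ (∏ h ∈ H, (n + h)).divisors.filter (fun d : ℕ => (d : ℝ) ≤ R),
      (ArithmeticFunction.moebius d : ℝ) * (Real.log (R / d)) ^ a

/-- |Ω_H(p)|: the number of residue classes mod p occupied by the elements of H. -/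
def residCard (H : Finset ℕ) (p : ℕ) : ℕ := (H.image (fun h => h % p)).card

/-- The singular series 𝔖(H) = ∏_p (1 - |Ω_H(p)|/p) (1 - 1/p)^{-|H|}. -/
noncomputable def singSeries (H : Finset ℕ) : ℝ :=
  ∏' p : Nat.Primes,
    ((1 - (residCard H (p : ℕ) : ℝ) / (p : ℕ)) * ((1 - 1 / ((p : ℕ) : ℝ)) ^ H.card)⁻¹)

/-- The primes that divide a nonzero difference of two elements of `H`. -/
def diffPrimes (H : Finset ℕ) : Finset ℕ :=
  (H ×ˢ H).biUnion fun x => (x.1 - x.2).primeFactors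

lemma prod_inv_one_sub_inv_le_card_add_one (S : Finset ℕ) (hS : ∀ p ∈ S, 2 ≤ p) :
    ∏ p ∈ S, (1 - 1 / (p : ℝ))⁻¹ ≤ (S.card : ℝ) + 1 := by
  induction S using Finset.induction_on_max with
  | empty => simp
  | insert a S hlt ih =>
    have haS : a ∉ S := fun h => lt_irrefl _ (hlt a h)
    rw [Finset.prod_insert haS, Finset.card_insert_of_notMem haS]
    have ih := ih fun p hp => hS p (Finset.mem_insert_of_mem hp)
    have ha := hS a (Finset.mem_insert_self _ _)
    have hcard : S.card + 2 ≤ a := by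
      have hsub : S ⊆ Finset.Ico 2 a := fun p hp =>
        Finset.mem_Ico.2 ⟨hS p (Finset.mem_insert_of_mem hp), hlt p hp⟩
      have := Finset.card_le_card hsub
      rw [Nat.card_Ico] at this
      omega
    have haR : (S.card : ℝ) + 2 ≤ a := by exact_mod_cast hcard
    have hc : (0 : ℝ) ≤ S.card := by positivity
    have hfac : (1 - 1 / (a : ℝ))⁻¹ ≤ ((S.card : ℝ) + 2) / (S.card + 1) := by
      have : (1 - 1 / (a : ℝ))⁻¹ = a / (a - 1) := by
        have h1 : (a : ℝ) ≠ 0 := by linarith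
        have h2 : (a : ℝ) - 1 ≠ 0 := by linarith
        field_simp
      rw [this, div_le_div_iff₀ (by linarith) (by linarith)]
      nlinarith
    have hnn : 0 ≤ ∏ p ∈ S, (1 - 1 / (p : ℝ))⁻¹ := by
      refine Finset.prod_nonneg fun p hp => inv_nonneg.2 ?_
      have h2 : (2 : ℝ) ≤ p := by exact_mod_cast hS p (Finset.mem_insert_of_mem hp)
      rw [sub_nonneg, div_le_one (by linarith)]
      linarith
    calc _ ≤ ((S.card : ℝ) + 2) / (S.card + 1) * (S.card + 1) :=
          mul_le_mul hfac ih hnn (by positivity)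
      _ = _ := by
        push_cast
        field_simp
        ring

lemma card_primeFactors_le_two_mul_log {n : ℕ} {x : ℝ} (hx : 1 ≤ x) (hn : (n : ℝ) ≤ x) :
    (n.primeFactors.card : ℝ) ≤ 2 * Real.log x := by
  rcases Nat.eq_zero_or_pos n with rfl | hpos
  · simpa using Real.log_nonneg hx
  have hpow : 2 ^ n.primeFactors.card ≤ n :=
    (Finset.pow_card_le_prod _ _ _ fun p hp => (Nat.prime_of_mem_primeFactors hp).two_le).trans
      (Nat.le_of_dvd hpos (Nat.prod_primeFactors_dvd n))
  have hlog : Real.log ((2 : ℝ) ^ n.primeFactors.card) ≤ Real.log x :=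
    Real.log_le_log (by positivity) (le_trans (by exact_mod_cast hpow) hn)
  rw [Real.log_pow] at hlog
  have hc : (0 : ℝ) ≤ n.primeFactors.card := by positivity
  nlinarith [Real.log_two_gt_d9]

lemma card_diffPrimes_le {H : Finset ℕ} {x : ℝ} (hx : 1 ≤ x) (hH : ∀ a ∈ H, (a : ℝ) ≤ x) :
    ((diffPrimes H).card : ℝ) ≤ 2 * (H.card : ℝ) ^ 2 * Real.log x := by
  calc ((diffPrimes H).card : ℝ)
      ≤ ((∑ y ∈ H ×ˢ H, (y.1 - y.2).primeFactors.card : ℕ) : ℝ) := by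
        exact_mod_cast Finset.card_biUnion_le
    _ = ∑ y ∈ H ×ˢ H, ((y.1 - y.2).primeFactors.card : ℝ) := by push_cast; rfl
    _ ≤ ∑ y ∈ H ×ˢ H, 2 * Real.log x := by
        refine Finset.sum_le_sum fun y hy => card_primeFactors_le_two_mul_log hx ?_
        exact le_trans (by exact_mod_cast Nat.sub_le _ _) (hH _ (Finset.mem_product.1 hy).1)
    _ = _ := by
        rw [Finset.sum_const, Finset.card_product, nsmul_eq_mul]
        push_cast
        ring

lemma residCard_eq_card {H : Finset ℕ} {p : ℕ} (hp : p.Prime) (hpH : p ∉ diffPrimes H) :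
    residCard H p = H.card := by
  have key : ∀ a ∈ H, ∀ b ∈ H, a % p = b % p → a ≤ b := by
    intro a ha b hb hab
    by_contra! hlt
    refine hpH (Finset.mem_biUnion.2 ⟨(a, b), Finset.mem_product.2 ⟨ha, hb⟩, ?_⟩)
    refine Nat.mem_primeFactors.2 ⟨hp, ?_, by simpa using Nat.sub_ne_zero_of_lt hlt⟩
    exact (Nat.modEq_iff_dvd' hlt.le).1 hab.symm
  exact Finset.card_image_of_injOn fun a ha b hb hab =>
    le_antisymm (key a ha b hb hab) (key b hb a ha hab.symm)

lemma residCard_le {H : Finset ℕ} {p : ℕ} (hp : 0 < p) : residCard H p ≤ p := by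
  have hsub : H.image (fun h => h % p) ⊆ Finset.range p := by
    intro y hy
    obtain ⟨a, -, rfl⟩ := Finset.mem_image.1 hy
    exact Finset.mem_range.2 (Nat.mod_lt _ hp)
  simpa [residCard] using Finset.card_le_card hsub

lemma singSeries_le {H : Finset ℕ} {x : ℝ} (hx : 1 ≤ x) (hH : ∀ a ∈ H, (a : ℝ) ≤ x) :
    singSeries H ≤ (2 * (H.card : ℝ) ^ 2 * Real.log x + 1) ^ H.card := by
  have hlog := Real.log_nonneg hx
  unfold singSeries
  set f : Nat.Primes → ℝ := fun p =>
    (1 - (residCard H (p : ℕ) : ℝ) / (p : ℕ)) * ((1 - 1 / ((p : ℕ) : ℝ)) ^ H.card)⁻¹ with hf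
  by_cases hm : Multipliable f
  swap
  · rw [tprod_eq_one_of_not_multipliable hm]
    exact one_le_pow₀ (by nlinarith [mul_nonneg (sq_nonneg (H.card : ℝ)) hlog])
  refine le_of_tendsto hm.hasProd (Filter.Eventually.of_forall fun S => ?_)
  have hpos : ∀ p : Nat.Primes, 0 < 1 - 1 / ((p : ℕ) : ℝ) := fun p => by
    have h2 : (1 : ℝ) < (p : ℕ) := by exact_mod_cast p.2.one_lt
    rw [sub_pos, div_lt_one (by linarith)]
    exact h2
  have hf0 : ∀ p, 0 ≤ f p := fun p => by
    refine mul_nonneg ?_ (inv_nonneg.2 (pow_nonneg (hpos p).le _))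
    have h2 : (0 : ℝ) < (p : ℕ) := by exact_mod_cast p.2.pos
    rw [sub_nonneg, div_le_one h2]
    exact_mod_cast residCard_le p.2.pos
  have hf_le : ∀ p, f p ≤
      (if (p : ℕ) ∈ diffPrimes H then (1 - 1 / ((p : ℕ) : ℝ))⁻¹ else 1) ^ H.card := by
    intro p
    have hpw := pow_pos (hpos p) H.card
    split_ifs with hp
    · rw [inv_pow]
      refine mul_le_of_le_one_left (inv_nonneg.2 hpw.le) ?_
      have : (0 : ℝ) ≤ (residCard H (p : ℕ) : ℝ) / (p : ℕ) := by positivity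
      linarith
    · rw [one_pow, hf]
      simp only
      rw [residCard_eq_card p.2 hp, mul_inv_le_iff₀ hpw, one_mul]
      have hb := one_add_mul_le_pow (a := -(1 / ((p : ℕ) : ℝ))) (by linarith [hpos p]) H.card
      calc _ = 1 + (H.card : ℝ) * -(1 / ((p : ℕ) : ℝ)) := by ring
        _ ≤ _ := hb
        _ = _ := by ring
  set T : Finset ℕ := (S.filter fun p : Nat.Primes => (p : ℕ) ∈ diffPrimes H).image
    (fun p : Nat.Primes => (p : ℕ))
  have hTprime : ∀ p ∈ T, 2 ≤ p := by
    intro p hp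
    obtain ⟨q, -, rfl⟩ := Finset.mem_image.1 hp
    exact q.2.two_le
  have hTsub : T ⊆ diffPrimes H := by
    intro p hp
    obtain ⟨q, hq, rfl⟩ := Finset.mem_image.1 hp
    exact (Finset.mem_filter.1 hq).2
  have hTcard : (T.card : ℝ) ≤ (diffPrimes H).card := by exact_mod_cast Finset.card_le_card hTsub
  calc ∏ p ∈ S, f p
      ≤ ∏ p ∈ S, (if (p : ℕ) ∈ diffPrimes H then (1 - 1 / ((p : ℕ) : ℝ))⁻¹ else 1) ^ H.card :=
        Finset.prod_le_prod (fun p _ => hf0 p) fun p _ => hf_le p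
    _ = (∏ p ∈ T, (1 - 1 / (p : ℝ))⁻¹) ^ H.card := by
        rw [Finset.prod_pow, ← Finset.prod_filter]
        congr 1
        exact (Finset.prod_image (f := fun p : ℕ => (1 - 1 / (p : ℝ))⁻¹)
          fun a _ b _ hab => Nat.Primes.coe_nat_injective hab).symm
    _ ≤ _ := by
        refine pow_le_pow_left₀ (Finset.prod_nonneg fun p hp => ?_) ?_ _
        · obtain ⟨q, -, rfl⟩ := Finset.mem_image.1 hp
          exact inv_nonneg.2 (hpos q).le
        · linarith [prod_inv_one_sub_inv_le_card_add_one T hTprime, card_diffPrimes_le hx hH]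

lemma card_powersetCard_filter_mem_le (I : Finset ℕ) (k x : ℕ) :
    ((I.powersetCard k).filter (x ∈ ·)).card ≤ I.card ^ (k - 1) := by
  calc _ ≤ (I.powersetCard (k - 1)).card := by
        refine Finset.card_le_card_of_injOn (fun s => s.erase x) ?_ ?_
        · intro s hs
          obtain ⟨hs, hxs⟩ := Finset.mem_filter.1 hs
          obtain ⟨hsI, hsk⟩ := Finset.mem_powersetCard.1 hs
          refine Finset.mem_coe.2 (Finset.mem_powersetCard.2
            ⟨(Finset.erase_subset _ _).trans hsI, ?_⟩)
          rw [Finset.card_erase_of_mem hxs, hsk]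
        · intro s hs t ht hst
          rw [← Finset.insert_erase (Finset.mem_filter.1 hs).2,
            ← Finset.insert_erase (Finset.mem_filter.1 ht).2]
          exact congrArg _ hst
    _ ≤ _ := by
        rw [Finset.card_powersetCard]
        exact Nat.choose_le_pow _ _

/-- The number of tuples of `k i`-subsets of `I i` whose members of index `i` and `j` share
a given element. -/
lemma card_filter_mem_mem_le {l : ℕ} {k : Fin l → ℕ} (hk : ∀ i, 0 < k i)
    {I : Fin l → Finset ℕ} {D : Fin l → ℝ} (hD : ∀ i, 0 < D i)
    (hI : ∀ i, ((I i).card : ℝ) ≤ D i) {i j : Fin l} (hij : i ≠ j) (x : ℕ) :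
    (((Fintype.piFinset fun t => (I t).powersetCard (k t)).filter
      fun A => x ∈ A i ∧ x ∈ A j).card : ℝ) ≤ (∏ t, D t ^ k t) * (D i)⁻¹ * (D j)⁻¹ := by
  have hsub : ((Fintype.piFinset fun t => (I t).powersetCard (k t)).filter
      fun A => x ∈ A i ∧ x ∈ A j) ⊆ Fintype.piFinset fun t =>
        if t = i ∨ t = j then ((I t).powersetCard (k t)).filter (x ∈ ·)
        else (I t).powersetCard (k t) := by
    intro A hA
    obtain ⟨hA, hi, hj⟩ := Finset.mem_filter.1 hA
    rw [Fintype.mem_piFinset] at hA ⊢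
    intro t
    split_ifs with ht
    · refine Finset.mem_filter.2 ⟨hA t, ?_⟩
      rcases ht with rfl | rfl <;> assumption
    · exact hA t
  refine (Nat.cast_le.2 (Finset.card_le_card hsub)).trans ?_
  rw [Fintype.card_piFinset, Nat.cast_prod]
  have hmem : ∀ t, ((((I t).powersetCard (k t)).filter (x ∈ ·)).card : ℝ) ≤
      D t ^ k t * (D t)⁻¹ := by
    intro t
    have h1 : D t ^ k t * (D t)⁻¹ = D t ^ (k t - 1) := by
      obtain ⟨n, hn⟩ := Nat.exists_eq_add_of_lt (hk t)
      have := (hD t).ne'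
      rw [hn, zero_add, Nat.add_sub_cancel, pow_succ]
      field_simp
    rw [h1]
    calc _ ≤ ((I t).card : ℝ) ^ (k t - 1) := by
          exact_mod_cast card_powersetCard_filter_mem_le (I t) (k t) x
      _ ≤ _ := pow_le_pow_left₀ (by positivity) (hI t) _
  calc _ ≤ ∏ t, (D t ^ k t * (if t = i then (D t)⁻¹ else 1) * (if t = j then (D t)⁻¹ else 1)) := by
        refine Finset.prod_le_prod (fun _ _ => Nat.cast_nonneg _) fun t _ => ?_
        by_cases hti : t = i
        · have htj : t ≠ j := fun h => hij (hti.symm.trans h)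
          simpa [hti, hij] using hmem i
        · by_cases htj : t = j
          · simpa [htj, hij.symm] using hmem j
          · simp only [hti, htj, or_self, if_false, mul_one, Finset.card_powersetCard]
            calc _ ≤ ((I t).card : ℝ) ^ k t := by exact_mod_cast Nat.choose_le_pow _ _
              _ ≤ _ := pow_le_pow_left₀ (by positivity) (hI t) _
    _ = _ := by
        rw [Finset.prod_mul_distrib, Finset.prod_mul_distrib]
        simp only [Finset.prod_ite_eq', Finset.mem_univ, if_true]

lemma card_filter_not_disjoint_le {l : ℕ} {k : Fin l → ℕ} (hk : ∀ i, 0 < k i)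
    {I : Fin l → Finset ℕ} {D : Fin l → ℝ} {E : ℝ} (hE : 0 < E) (hD : ∀ i, E ≤ D i)
    (hI : ∀ i, ((I i).card : ℝ) ≤ D i) :
    (((Fintype.piFinset fun t => (I t).powersetCard (k t)).filter
      fun A => (Finset.univ.biUnion A).card < ∑ i, k i).card : ℝ) ≤
        (l : ℝ) ^ 2 * ((∏ t, D t ^ k t) * E⁻¹) := by
  have hD0 : ∀ i, 0 < D i := fun i => hE.trans_le (hD i)
  have hP : 0 ≤ ∏ t, D t ^ k t := Finset.prod_nonneg fun t _ => (pow_pos (hD0 t) _).le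
  set F := Fintype.piFinset fun t => (I t).powersetCard (k t) with hF
  have hsub : (F.filter fun A => (Finset.univ.biUnion A).card < ∑ i, k i) ⊆
      (Finset.univ : Finset (Fin l)).offDiag.biUnion fun y => (I y.1).biUnion fun x =>
        F.filter fun A => x ∈ A y.1 ∧ x ∈ A y.2 := by
    intro A hA
    obtain ⟨hA, hlt⟩ := Finset.mem_filter.1 hA
    have hA' := Fintype.mem_piFinset.1 hA
    have hnd : ¬ ∀ i j, i ≠ j → Disjoint (A i) (A j) := by
      intro hd
      rw [Finset.card_biUnion fun i _ j _ hij => hd i j hij] at hlt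
      exact hlt.ne (Finset.sum_congr rfl fun i _ => (Finset.mem_powersetCard.1 (hA' i)).2)
    push Not at hnd
    obtain ⟨i, j, hij, hd⟩ := hnd
    obtain ⟨x, hxi, hxj⟩ := Finset.not_disjoint_iff.1 hd
    simp only [Finset.mem_biUnion]
    exact ⟨(i, j), by simpa using hij, x, (Finset.mem_powersetCard.1 (hA' i)).1 hxi,
      Finset.mem_filter.2 ⟨hA, hxi, hxj⟩⟩
  have hpair : ∀ y ∈ (Finset.univ : Finset (Fin l)).offDiag,
      ((((I y.1).biUnion fun x => F.filter fun A => x ∈ A y.1 ∧ x ∈ A y.2).card : ℕ) : ℝ) ≤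
        (∏ t, D t ^ k t) * E⁻¹ := by
    intro y hy
    have hij : y.1 ≠ y.2 := (Finset.mem_offDiag.1 hy).2.2
    calc _ ≤ ((∑ x ∈ I y.1, (F.filter fun A => x ∈ A y.1 ∧ x ∈ A y.2).card : ℕ) : ℝ) := by
          exact_mod_cast Finset.card_biUnion_le
      _ = ∑ x ∈ I y.1, ((F.filter fun A => x ∈ A y.1 ∧ x ∈ A y.2).card : ℝ) := by
          push_cast; rfl
      _ ≤ ∑ x ∈ I y.1, (∏ t, D t ^ k t) * (D y.1)⁻¹ * (D y.2)⁻¹ :=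
          Finset.sum_le_sum fun x _ => card_filter_mem_mem_le hk hD0 hI hij x
      _ = ((I y.1).card : ℝ) * (D y.1)⁻¹ * ((∏ t, D t ^ k t) * (D y.2)⁻¹) := by
          rw [Finset.sum_const, nsmul_eq_mul]; ring
      _ ≤ 1 * ((∏ t, D t ^ k t) * E⁻¹) := by
          have h1 : ((I y.1).card : ℝ) * (D y.1)⁻¹ ≤ 1 := by
            rw [mul_inv_le_iff₀ (hD0 _), one_mul]; exact hI _
          have h2 : (D y.2)⁻¹ ≤ E⁻¹ := inv_anti₀ hE (hD _)
          have h3 : 0 ≤ (D y.2)⁻¹ := inv_nonneg.2 (hD0 _).le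
          exact mul_le_mul h1 (mul_le_mul_of_nonneg_left h2 hP) (mul_nonneg hP h3) zero_le_one
      _ = _ := one_mul _
  calc _ ≤ ((∑ y ∈ (Finset.univ : Finset (Fin l)).offDiag,
        ((I y.1).biUnion fun x => F.filter fun A => x ∈ A y.1 ∧ x ∈ A y.2).card : ℕ) : ℝ) := by
        exact_mod_cast (Finset.card_le_card hsub).trans Finset.card_biUnion_le
    _ ≤ ∑ y ∈ (Finset.univ : Finset (Fin l)).offDiag, (∏ t, D t ^ k t) * E⁻¹ := by
        rw [Nat.cast_sum]
        exact Finset.sum_le_sum hpair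
    _ ≤ _ := by
        rw [Finset.sum_const, nsmul_eq_mul]
        refine mul_le_mul_of_nonneg_right ?_ (mul_nonneg hP (inv_nonneg.2 hE.le))
        rw [Finset.offDiag_card, Finset.card_univ, Fintype.card_fin, sq]
        exact_mod_cast Nat.sub_le _ _

lemma card_Icc_ceil_floor_le {b c : ℝ} (hb : 0 ≤ b) (hbc : b + 1 ≤ c) :
    ((Finset.Icc ⌈b⌉₊ ⌊c⌋₊).card : ℝ) ≤ 2 * (c - b) := by
  have h1 := Nat.le_ceil b
  have h2 := Nat.floor_le (show 0 ≤ c by linarith)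
  have h3 : ⌈b⌉₊ ≤ ⌊c⌋₊ + 1 := by
    rw [Nat.ceil_le]
    push_cast
    linarith [Nat.lt_floor_add_one c]
  rw [Nat.card_Icc, Nat.cast_sub h3]
  push_cast
  linarith

/-- The contribution of the non-pairwise-disjoint tuples to the singular series average
is negligible. -/
theorem singular_series_nondisjoint_bound (l : ℕ) (hl : 1 ≤ l) (k : Fin l → ℕ)
    (hk : ∀ i, 0 < k i) (r : ℕ) (hr : r = ∑ i, k i) (δ : ℝ) (hδ0 : 0 < δ) (hδ1 : δ < 1) :
    ∃ C h₀ : ℝ, 0 < C ∧ 3 ≤ h₀ ∧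
      ∀ h : ℝ, h₀ ≤ h → ∀ B Cv : Fin l → ℝ,
        (∀ i, 0 ≤ B i) → (∀ i, Cv i ≤ h) → (∀ i, h ^ δ ≤ Cv i - B i) →
        (∑ A ∈ (Fintype.piFinset (fun i =>
              (Finset.Icc ⌈B i⌉₊ ⌊Cv i⌋₊).powerset.filter (fun s => s.card = k i))).filter
              (fun A => (Finset.univ.biUnion A).card < r),
            singSeries (Finset.univ.biUnion A)) ≤
          C * h ^ (-δ) * (Real.log h) ^ r * ∏ i, (Cv i - B i) ^ (k i) := by
  subst hr
  have hl0 : (0 : ℝ) < l := by exact_mod_cast hl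
  refine ⟨(l : ℝ) ^ 2 * 2 ^ (∑ i, k i) * (2 * ((∑ i, k i : ℕ) : ℝ) ^ 2 + 1) ^ (∑ i, k i), 3,
    by positivity, le_rfl, ?_⟩
  intro h hh B Cv hB hC hBC
  set r := ∑ i, k i with hr
  have hlog : 1 ≤ Real.log h := by
    rw [Real.le_log_iff_exp_le (by linarith)]
    linarith [Real.exp_one_lt_d9]
  have hE : 1 ≤ h ^ δ := Real.one_le_rpow (by linarith) hδ0.le
  simp only [← Finset.powersetCard_eq_filter]
  set I : Fin l → Finset ℕ := fun i => Finset.Icc ⌈B i⌉₊ ⌊Cv i⌋₊ with hI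
  have hcount := card_filter_not_disjoint_le (k := k) hk (I := I)
    (D := fun i => 2 * (Cv i - B i)) (E := h ^ δ) (by linarith)
    (fun i => by linarith [hBC i])
    fun i => card_Icc_ceil_floor_le (hB i) (by linarith [hBC i])
  have hbound : ∀ A ∈ (Fintype.piFinset fun i => (I i).powersetCard (k i)).filter
      (fun A => (Finset.univ.biUnion A).card < r),
      singSeries (Finset.univ.biUnion A) ≤ ((2 * (r : ℝ) ^ 2 + 1) * Real.log h) ^ r := by
    intro A hA
    obtain ⟨hA, hlt⟩ := Finset.mem_filter.1 hA
    have hle : ∀ a ∈ Finset.univ.biUnion A, (a : ℝ) ≤ h := by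
      intro a ha
      obtain ⟨i, -, hai⟩ := Finset.mem_biUnion.1 ha
      have haI := (Finset.mem_powersetCard.1 (Fintype.mem_piFinset.1 hA i)).1 hai
      have hCi : 0 ≤ Cv i := by linarith [hB i, hBC i]
      exact ((Nat.le_floor_iff hCi).1 (Finset.mem_Icc.1 haI).2).trans (hC i)
    have hltR : ((Finset.univ.biUnion A).card : ℝ) ≤ r := by exact_mod_cast hlt.le
    refine (singSeries_le (by linarith) hle).trans ?_
    have hbase : 2 * ((Finset.univ.biUnion A).card : ℝ) ^ 2 * Real.log h + 1 ≤
        (2 * (r : ℝ) ^ 2 + 1) * Real.log h := by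
      have : ((Finset.univ.biUnion A).card : ℝ) ^ 2 ≤ (r : ℝ) ^ 2 :=
        pow_le_pow_left₀ (by positivity) hltR 2
      nlinarith
    refine (pow_le_pow_left₀ (by positivity) hbase _).trans (pow_le_pow_right₀ ?_ hlt.le)
    nlinarith [sq_nonneg (r : ℝ)]
  refine (Finset.sum_le_card_nsmul _ _ _ hbound).trans ?_
  rw [nsmul_eq_mul]
  refine (mul_le_mul_of_nonneg_right hcount (by positivity)).trans (le_of_eq ?_)
  simp only [mul_pow, Finset.prod_mul_distrib, Finset.prod_pow_eq_pow_sum]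
  rw [Real.rpow_neg (by linarith), ← hr]
  ring
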